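/- Algebraic convergence of the time fractional gradient flow for strongly convex potentials: let φ : ℝ^d → ℝ be continuously differentiable and μ-strongly convex for some μ > 0 (i.e., x ↦ φ(x) − (μ/2)|x|² is convex), and let u* be the global minimizer of φ. Let u : [0,∞) → ℝ^d be continuous and satisfy the Volterra integral equation u(t) = u_0 − (1/Γ(α)) ∫_0^t (t−s)^{α−1} ∇φ(u(s)) ds for all t ≥ 0 (the integral formulation of D_c^α u = −∇φ(u), u(0) = u_0). Then φ(u(t)) − φ(u*) ≤ (φ(u_0) − φ(u*)) · E_α(−2μ t^α) for all t ≥ 0, and there exists C > 0 such that |u(t) − u*| ≤ C (1 + t)^{−α/2} for all t ≥ 0, where E_α(z) = Σ_{n=0}^∞ z^n/Γ(nα+1) is the Mittag-Leffler function. -/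

import Mathlib

/-- The Mittag-Leffler function `E_α(z) = Σ_{n=0}^∞ z^n / Γ(nα + 1)`. -/
noncomputable def mittagLeffler (α z : ℝ) : ℝ :=
  ∑' n : ℕ, z ^ n / Real.Gamma ((n : ℝ) * α + 1)

/-- The unnormalised Riemann–Liouville (Abel) integral `∫₀ᵗ (t - s)^(α - 1) q(s) ds`. -/
noncomputable def abelIntegral (α : ℝ) (q : ℝ → ℝ) (t : ℝ) : ℝ :=
  ∫ s in (0 : ℝ)..t, (t - s) ^ (α - 1) * q s

theorem intervalIntegrable_sub_rpow {α : ℝ} (hα : 0 < α) (a b t : ℝ) :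
    IntervalIntegrable (fun s : ℝ => (t - s) ^ (α - 1)) MeasureTheory.volume a b := by
  have h := (intervalIntegral.intervalIntegrable_rpow' (a := t - a) (b := t - b)
    (show -1 < α - 1 by linarith)).comp_sub_left t
  simpa using h

theorem intervalIntegrable_rpow_sub {α : ℝ} (hα : 0 < α) (a b t : ℝ) :
    IntervalIntegrable (fun s : ℝ => (s - t) ^ (α - 1)) MeasureTheory.volume a b := by
  have h := (intervalIntegral.intervalIntegrable_rpow' (a := a - t) (b := b - t)
    (show -1 < α - 1 by linarith)).comp_sub_right t
  simpa using h

theorem intervalIntegrable_abel {α : ℝ} (hα : 0 < α) {q : ℝ → ℝ} (hq : Continuous q)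
    (a b t : ℝ) :
    IntervalIntegrable (fun s : ℝ => (t - s) ^ (α - 1) * q s) MeasureTheory.volume a b :=
  (intervalIntegrable_sub_rpow hα a b t).mul_continuousOn hq.continuousOn

theorem integral_sub_rpow {α : ℝ} (hα : 0 < α) (a t : ℝ) :
    ∫ s in a..t, (t - s) ^ (α - 1) = (t - a) ^ α / α := by
  rw [intervalIntegral.integral_comp_sub_left (fun x : ℝ => x ^ (α - 1)) t,
    integral_rpow (Or.inl (by linarith))]
  simp [Real.zero_rpow hα.ne']

/-- The Riemann–Liouville kernel integrates explicitly against `(t - s)^(-1 - α)`. -/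
theorem integral_rpow_mul_sub_rpow {α r b t : ℝ} (hα : 0 < α) (hrb : r ≤ b) (hbt : b < t) :
    ∫ s in r..b, α * (t - s) ^ (-1 - α) * (s - r) ^ (α - 1)
      = (b - r) ^ α * (t - b) ^ (-α) / (t - r) := by
  have hint : IntervalIntegrable (fun s : ℝ => α * (t - s) ^ (-1 - α) * (s - r) ^ (α - 1))
      MeasureTheory.volume r b := by
    refine (intervalIntegrable_rpow_sub hα r b r).continuousOn_mul ?_
    rw [Set.uIcc_of_le hrb]
    refine continuousOn_const.mul (ContinuousOn.rpow_const (by fun_prop) ?_)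
    intro s hs
    left
    have := hs.2
    linarith
  have hFTC := intervalIntegral.integral_eq_sub_of_hasDerivAt_of_le
    (f := fun s : ℝ => (s - r) ^ α * (t - s) ^ (-α) / (t - r)) hrb ?_ ?_ hint
  · rw [hFTC]
    simp [Real.zero_rpow hα.ne']
  · refine ContinuousOn.div_const (ContinuousOn.mul ?_ ?_) _
    · exact ContinuousOn.rpow_const (by fun_prop) fun s _ => Or.inr hα.le
    · refine ContinuousOn.rpow_const (by fun_prop) fun s hs => Or.inl ?_
      have := hs.2
      linarith
  · intro s hs
    have h1 : 0 < s - r := sub_pos.2 hs.1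
    have h2 : 0 < t - s := by linarith [hs.2]
    have h3 : 0 < t - r := by linarith
    have d1 : HasDerivAt (fun s : ℝ => (s - r) ^ α) (1 * α * (s - r) ^ (α - 1)) s :=
      ((hasDerivAt_id s).sub_const r).rpow_const (Or.inl h1.ne')
    have d2 : HasDerivAt (fun s : ℝ => (t - s) ^ (-α)) (-1 * (-α) * (t - s) ^ (-α - 1)) s :=
      ((hasDerivAt_id s).const_sub t).rpow_const (Or.inl h2.ne')
    convert! (d1.mul d2).div_const (t - r) using 1
    have e1 : (s - r) ^ α = (s - r) ^ (α - 1) * (s - r) := by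
      rw [← Real.rpow_add_one h1.ne']; congr 1; ring
    have e2 : (t - s) ^ (-α) = (t - s) ^ (-1 - α) * (t - s) := by
      rw [← Real.rpow_add_one h2.ne']; congr 1; ring
    have e3 : -α - 1 = -1 - α := by ring
    rw [e3, e1, e2]
    field_simp
    ring

open MeasureTheory in
/-- Fubini for a weighted Riemann–Liouville integral, together with the integrability of both
iterated integrals. -/
theorem integral_mul_abelIntegral {α b : ℝ} (hα : 0 < α) (hb : 0 ≤ b) {q w : ℝ → ℝ}
    (hq : Continuous q) (hw : ContinuousOn w (Set.Icc 0 b)) :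
    IntervalIntegrable (fun s => w s * abelIntegral α q s) volume 0 b ∧
    IntervalIntegrable (fun r => q r * ∫ s in r..b, w s * (s - r) ^ (α - 1)) volume 0 b ∧
    ∫ s in (0 : ℝ)..b, w s * abelIntegral α q s
      = ∫ r in (0 : ℝ)..b, q r * ∫ s in r..b, w s * (s - r) ^ (α - 1) := by
  set f : ℝ → ℝ := (Set.Ioc 0 b).indicator q with hf
  set g : ℝ → ℝ := (Set.Ioc 0 b).indicator (fun x => x ^ (α - 1)) with hg
  set W : ℝ → ℝ := (Set.Ioc 0 b).indicator w with hW
  have hfi : Integrable f volume :=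
    ((hq.intervalIntegrable 0 b).1).integrable_indicator measurableSet_Ioc
  have hgi : Integrable g volume :=
    ((intervalIntegral.intervalIntegrable_rpow' (a := 0) (b := b)
      (show -1 < α - 1 by linarith)).1).integrable_indicator measurableSet_Ioc
  have hWm : AEStronglyMeasurable W volume := by
    rw [hW, aestronglyMeasurable_indicator_iff measurableSet_Ioc]
    exact (hw.mono Set.Ioc_subset_Icc_self).aestronglyMeasurable measurableSet_Ioc
  obtain ⟨B, hB⟩ := isCompact_Icc.exists_bound_of_continuousOn hw
  have hWb : ∀ x, ‖W x‖ ≤ max B 0 := by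
    intro x
    by_cases hx : x ∈ Set.Ioc 0 b
    · rw [hW, Set.indicator_of_mem hx]
      exact (hB x (Set.Ioc_subset_Icc_self hx)).trans (le_max_left _ _)
    · rw [hW, Set.indicator_of_notMem hx]
      simp
  have hconv := hfi.convolution_integrand (ContinuousLinearMap.mul ℝ ℝ) hgi
  have hF : Integrable (Function.uncurry fun s r => W s * (f r * g (s - r)))
      (volume.prod volume) :=
    hconv.bdd_mul (f := fun p : ℝ × ℝ => W p.1) hWm.comp_fst
      (Filter.Eventually.of_forall fun p => hWb p.1)
  have hL : (fun s => ∫ r, W s * (f r * g (s - r)))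
      = (Set.Ioc 0 b).indicator (fun s => w s * abelIntegral α q s) := by
    funext s
    by_cases hs : s ∈ Set.Ioc 0 b
    · rw [Set.indicator_of_mem hs, hW, Set.indicator_of_mem hs, integral_const_mul,
        abelIntegral, intervalIntegral.integral_of_le hs.1.le, integral_Ioc_eq_integral_Ioo,
        ← integral_indicator measurableSet_Ioo]
      congr 2
      funext r
      by_cases hr : r ∈ Set.Ioo 0 s
      · rw [Set.indicator_of_mem hr, hf, hg, Set.indicator_of_mem
          (show r ∈ Set.Ioc 0 b from ⟨hr.1, hr.2.le.trans hs.2⟩),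
          Set.indicator_of_mem (show s - r ∈ Set.Ioc 0 b from
            ⟨sub_pos.2 hr.2, by linarith [hr.1, hs.2]⟩), mul_comm]
      · rw [Set.indicator_of_notMem hr]
        by_cases h0 : 0 < r
        · have : s - r ∉ Set.Ioc 0 b := fun h => hr ⟨h0, sub_pos.1 h.1⟩
          rw [hg, Set.indicator_of_notMem this, mul_zero]
        · have : r ∉ Set.Ioc 0 b := fun h => h0 h.1
          rw [hf, Set.indicator_of_notMem this, zero_mul]
    · rw [Set.indicator_of_notMem hs, hW, Set.indicator_of_notMem hs]
      simp
  have hR : (fun r => ∫ s, W s * (f r * g (s - r)))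
      = (Set.Ioc 0 b).indicator (fun r => q r * ∫ s in r..b, w s * (s - r) ^ (α - 1)) := by
    funext r
    by_cases hr : r ∈ Set.Ioc 0 b
    · rw [Set.indicator_of_mem hr, hf, Set.indicator_of_mem hr,
        intervalIntegral.integral_of_le hr.2,
        ← integral_indicator measurableSet_Ioc, ← integral_const_mul]
      congr 1
      funext s
      by_cases hs : s ∈ Set.Ioc r b
      · rw [Set.indicator_of_mem hs, hW, hg, Set.indicator_of_mem
          (show s ∈ Set.Ioc 0 b from ⟨hr.1.trans hs.1, hs.2⟩),
          Set.indicator_of_mem (show s - r ∈ Set.Ioc 0 b from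
            ⟨sub_pos.2 hs.1, by linarith [hr.1, hs.2]⟩)]
        ring
      · rw [Set.indicator_of_notMem hs]
        by_cases h0 : r < s
        · have : s ∉ Set.Ioc 0 b := fun h => hs ⟨h0, h.2⟩
          rw [hW, Set.indicator_of_notMem this]
          ring
        · have : s - r ∉ Set.Ioc 0 b := fun h => h0 (sub_pos.1 h.1)
          rw [hg, Set.indicator_of_notMem this]
          ring
    · rw [Set.indicator_of_notMem hr, hf, Set.indicator_of_notMem hr]
      simp
  have hIL := hF.integral_prod_left
  have hIR := hF.integral_prod_right
  simp only [Function.uncurry_apply_pair] at hIL hIR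
  rw [hL] at hIL
  rw [hR] at hIR
  refine ⟨?_, ?_, ?_⟩
  · rw [intervalIntegrable_iff_integrableOn_Ioc_of_le hb]
    exact (integrable_indicator_iff measurableSet_Ioc).1 hIL
  · rw [intervalIntegrable_iff_integrableOn_Ioc_of_le hb]
    exact (integrable_indicator_iff measurableSet_Ioc).1 hIR
  · have := integral_integral_swap hF
    rw [hL, hR, integral_indicator measurableSet_Ioc, integral_indicator measurableSet_Ioc] at this
    rw [intervalIntegral.integral_of_le hb, intervalIntegral.integral_of_le hb, this]

open MeasureTheory in
/-- If the Riemann–Liouville integral of `q` on `[0, t]` is smallest at the end point `t`, then it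
is dominated by an explicit truncated average. -/
theorem abelIntegral_le_of_isMinOn {α b t : ℝ} (hα : 0 < α) (hb : 0 < b) (hbt : b < t)
    {q : ℝ → ℝ} (hq : Continuous q)
    (hmin : ∀ s ∈ Set.Icc 0 t, abelIntegral α q t ≤ abelIntegral α q s) :
    IntervalIntegrable (fun r => q r * ((b - r) ^ α / (t - r))) volume 0 b ∧
    abelIntegral α q t ≤ ∫ r in (0 : ℝ)..b, q r * ((b - r) ^ α / (t - r)) := by
  have hε : 0 < t - b := sub_pos.2 hbt
  have ht : 0 < t := hb.trans hbt
  have hεα : 0 < (t - b) ^ (-α) := Real.rpow_pos_of_pos hε _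
  have hwc : ContinuousOn (fun s : ℝ => α * (t - s) ^ (-1 - α)) (Set.Icc 0 b) := by
    refine continuousOn_const.mul (ContinuousOn.rpow_const (by fun_prop) fun s hs => Or.inl ?_)
    have := hs.2
    linarith
  obtain ⟨hi1, hi2, hfub⟩ := integral_mul_abelIntegral hα hb.le hq hwc
  have hinner : Set.EqOn
      (fun r => q r * ∫ s in r..b, α * (t - s) ^ (-1 - α) * (s - r) ^ (α - 1))
      (fun r => (t - b) ^ (-α) * (q r * ((b - r) ^ α / (t - r)))) (Set.uIcc 0 b) := by
    intro r hr
    rw [Set.uIcc_of_le hb.le] at hr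
    simp only []
    rw [integral_rpow_mul_sub_rpow hα hr.2 hbt]
    ring
  have hi3 : IntervalIntegrable (fun r => q r * ((b - r) ^ α / (t - r))) volume 0 b := by
    have h := (hi2.congr (fun r hr => hinner (Set.uIoc_subset_uIcc hr))).const_mul
      ((t - b) ^ (-α))⁻¹
    refine h.congr fun r _ => ?_
    simp only []
    rw [inv_mul_cancel_left₀ hεα.ne']
  refine ⟨hi3, ?_⟩
  have hweight : ∫ s in (0 : ℝ)..b, α * (t - s) ^ (-1 - α) = (t - b) ^ (-α) - t ^ (-α) := by
    rw [intervalIntegral.integral_const_mul,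
      intervalIntegral.integral_comp_sub_left (fun x : ℝ => x ^ (-1 - α)) t, integral_rpow]
    · have : -1 - α + 1 = -α := by ring
      rw [this, sub_zero]
      field_simp
      ring
    · right
      refine ⟨by linarith, ?_⟩
      rw [Set.uIcc_of_le (by linarith)]
      intro h
      have := h.1
      linarith
  have hcmp : ∫ s in (0 : ℝ)..b, α * (t - s) ^ (-1 - α) * abelIntegral α q t
      ≤ ∫ s in (0 : ℝ)..b, α * (t - s) ^ (-1 - α) * abelIntegral α q s := by
    refine intervalIntegral.integral_mono_on hb.le ?_ hi1 fun s hs => ?_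
    · refine (hwc.mul continuousOn_const).intervalIntegrable_of_Icc hb.le
    · refine mul_le_mul_of_nonneg_left (hmin s ⟨hs.1, hs.2.trans hbt.le⟩) ?_
      have : 0 < t - s := by linarith [hs.2]
      positivity
  rw [intervalIntegral.integral_mul_const, hweight, hfub,
    intervalIntegral.integral_congr hinner, intervalIntegral.integral_const_mul] at hcmp
  have h0 : abelIntegral α q t ≤ 0 := by
    simpa [abelIntegral] using hmin 0 ⟨le_rfl, ht.le⟩
  have htα : 0 < t ^ (-α) := Real.rpow_pos_of_pos ht _
  have : t ^ (-α) * abelIntegral α q t ≤ 0 := mul_nonpos_of_nonneg_of_nonpos htα.le h0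
  refine le_of_mul_le_mul_left ?_ hεα
  linarith

theorem rpow_sub_one_sub_div_mem_Icc {α x ε : ℝ} (hα : α ∈ Set.Ioo (0 : ℝ) 1) (hε : 0 < ε)
    (hx : ε ≤ x) :
    x ^ (α - 1) - (x - ε) ^ α / x ∈ Set.Icc 0 (ε * x ^ (α - 2)) := by
  have hx0 : 0 < x := hε.trans_le hx
  have e1 : x ^ (α - 1) = x ^ α / x := by rw [Real.rpow_sub_one hx0.ne']
  have e2 : ε * x ^ (α - 2) = (x ^ α * (ε / x)) / x := by
    have h2 : x ^ (α - 2) = x ^ α / x ^ 2 := by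
      rw [Real.rpow_sub hx0]; norm_num
    rw [h2]
    field_simp
  rw [e1, e2, ← sub_div]
  constructor
  · refine div_nonneg (sub_nonneg.2 ?_) hx0.le
    exact Real.rpow_le_rpow (by linarith) (by linarith) hα.1.le
  · refine div_le_div_of_nonneg_right ?_ hx0.le
    have h0 : 0 ≤ 1 - ε / x := by
      rw [sub_nonneg, div_le_one hx0]; exact hx
    have h1 : 1 - ε / x ≤ 1 := by
      have : 0 < ε / x := by positivity
      linarith
    have h3 : (1 - ε / x) ≤ (1 - ε / x) ^ α := by
      have := Real.rpow_le_rpow_of_exponent_ge' h0 h1 hα.1.le hα.2.le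
      rwa [Real.rpow_one] at this
    have h4 : (x - ε) ^ α = x ^ α * (1 - ε / x) ^ α := by
      rw [← Real.mul_rpow hx0.le h0]; congr 1; field_simp
    rw [h4]
    have h5 : 0 < x ^ α := Real.rpow_pos_of_pos hx0 _
    nlinarith

open MeasureTheory in
/-- Fractional Fermat principle: if the Riemann–Liouville integral of order `α` of a continuous
function `q` attains its minimum over `[0, t]` at the right end point, then `q t ≤ 0`. -/
theorem nonpos_of_abelIntegral_min {α t : ℝ} (hα : α ∈ Set.Ioo (0 : ℝ) 1) (ht : 0 < t)
    {q : ℝ → ℝ} (hq : Continuous q)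
    (hmin : ∀ s ∈ Set.Icc 0 t, abelIntegral α q t ≤ abelIntegral α q s) : q t ≤ 0 := by
  by_contra! hqt
  obtain ⟨δ₀, hδ₀, hδq⟩ := Metric.continuous_iff.1 hq t (q t / 2) (half_pos hqt)
  set δ := min (δ₀ / 2) t with hδ
  have hδpos : 0 < δ := lt_min (half_pos hδ₀) ht
  have hqδ : ∀ r ∈ Set.Icc (t - δ) t, q t / 2 ≤ q r := by
    intro r hr
    have h1 : δ ≤ δ₀ / 2 := min_le_left _ _
    have := hδq r (by rw [Real.dist_eq, abs_lt]; constructor <;> linarith [hr.1, hr.2])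
    rw [Real.dist_eq, abs_lt] at this
    linarith [this.1]
  obtain ⟨B₀, hB₀⟩ := isCompact_Icc.exists_bound_of_continuousOn
    (hq.continuousOn (s := Set.Icc 0 t))
  set B := max B₀ 1 with hB
  have hBpos : 0 < B := lt_max_of_lt_right one_pos
  have hqB : ∀ r ∈ Set.Icc 0 t, -B ≤ q r := fun r hr =>
    (abs_le.1 ((hB₀ r hr).trans (le_max_left _ _))).1
  have hδα : 0 < δ ^ (α - 2) := Real.rpow_pos_of_pos hδpos _
  have key : ∀ ε ∈ Set.Ioo 0 δ, q t / 2 * (ε ^ α / α) ≤ t * (B * δ ^ (α - 2) * ε) := by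
    intro ε hε
    have hεt : ε < t := hε.2.trans_le (min_le_right _ _)
    obtain ⟨hi, hle⟩ := abelIntegral_le_of_isMinOn (b := t - ε) hα.1 (by linarith)
      (by linarith [hε.1]) hq hmin
    rw [abelIntegral, ← intervalIntegral.integral_add_adjacent_intervals
      (intervalIntegrable_abel hα.1 hq 0 (t - ε) t)
      (intervalIntegrable_abel hα.1 hq (t - ε) t t)] at hle
    have hnear : q t / 2 * (ε ^ α / α) ≤ ∫ s in (t - ε)..t, (t - s) ^ (α - 1) * q s := by
      have : ∫ s in (t - ε)..t, (t - s) ^ (α - 1) * (q t / 2) = q t / 2 * (ε ^ α / α) := by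
        rw [intervalIntegral.integral_mul_const, integral_sub_rpow hα.1, sub_sub_cancel, mul_comm]
      rw [← this]
      refine intervalIntegral.integral_mono_on (by linarith [hε.1])
        ((intervalIntegrable_sub_rpow hα.1 _ _ _).mul_const _)
        (intervalIntegrable_abel hα.1 hq _ _ _) fun s hs => ?_
      exact mul_le_mul_of_nonneg_left (hqδ s ⟨by linarith [hs.1, hε.2], hs.2⟩)
        (Real.rpow_nonneg (by linarith [hs.2]) _)
    have hfar : -(t * (B * δ ^ (α - 2) * ε)) ≤
        (∫ s in (0 : ℝ)..(t - ε), (t - s) ^ (α - 1) * q s)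
          - ∫ r in (0 : ℝ)..(t - ε), q r * ((t - ε - r) ^ α / (t - r)) := by
      have hK : 0 ≤ B * δ ^ (α - 2) * ε := by have := hε.1; positivity
      rw [← intervalIntegral.integral_sub (intervalIntegrable_abel hα.1 hq _ _ _) hi]
      have hc : ∫ _ in (0 : ℝ)..(t - ε), -(B * δ ^ (α - 2) * ε)
          = -((t - ε) * (B * δ ^ (α - 2) * ε)) := by
        rw [intervalIntegral.integral_const]; simp
      refine le_trans ?_ (hc ▸ intervalIntegral.integral_mono_on (by linarith)
        intervalIntegrable_const
        ((intervalIntegrable_abel hα.1 hq _ _ _).sub hi) fun r hr => ?_)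
      · nlinarith [hε.1]
      · have hx : ε ≤ t - r := by linarith [hr.2]
        have hm := rpow_sub_one_sub_div_mem_Icc hα hε.1 hx
        rw [show t - ε - r = t - r - ε by ring]
        set m := (t - r) ^ (α - 1) - (t - r - ε) ^ α / (t - r) with hmdef
        have hrw : (t - r) ^ (α - 1) * q r - q r * ((t - r - ε) ^ α / (t - r)) = q r * m := by
          rw [hmdef]; ring
        rw [hrw]
        by_cases hrδ : t - δ ≤ r
        · have := hqδ r ⟨hrδ, by linarith [hr.2, hε.1]⟩
          have : 0 ≤ q r * m := mul_nonneg (by linarith) hm.1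
          linarith
        · have h1 : (t - r) ^ (α - 2) ≤ δ ^ (α - 2) :=
            Real.rpow_le_rpow_of_nonpos hδpos (by linarith) (by linarith [hα.2])
          have h2 : m ≤ ε * δ ^ (α - 2) :=
            hm.2.trans (mul_le_mul_of_nonneg_left h1 hε.1.le)
          have h3 := hqB r ⟨hr.1, by linarith [hr.2, hε.1]⟩
          have h4 : -B * m ≤ q r * m := mul_le_mul_of_nonneg_right h3 hm.1
          nlinarith
    linarith
  set κ := q t / 2 / α / (t * (B * δ ^ (α - 2))) with hκ
  have hκpos : 0 < κ := by have := hα.1; positivity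
  have hκle : ∀ ε ∈ Set.Ioo 0 δ, κ ≤ ε ^ (1 - α) := by
    intro ε hε
    have h1 := key ε hε
    have h2 : ε = ε ^ α * ε ^ (1 - α) := by
      rw [← Real.rpow_add hε.1]; simp
    have h3 : 0 < ε ^ α := Real.rpow_pos_of_pos hε.1 _
    rw [hκ, div_le_iff₀ (by positivity)]
    refine le_of_mul_le_mul_left ?_ h3
    calc ε ^ α * (q t / 2 / α) = q t / 2 * (ε ^ α / α) := by ring
      _ ≤ t * (B * δ ^ (α - 2) * ε) := h1
      _ = t * (B * δ ^ (α - 2) * (ε ^ α * ε ^ (1 - α))) := by rw [← h2]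
      _ = _ := by ring
  have hlim : Filter.Tendsto (fun ε : ℝ => ε ^ (1 - α)) (nhdsWithin 0 (Set.Ioi 0)) (nhds 0) := by
    have h := (Real.continuousAt_rpow_const 0 (1 - α) (Or.inr (by linarith [hα.2]))).tendsto
    rw [Real.zero_rpow (by linarith [hα.2])] at h
    exact h.mono_left nhdsWithin_le_nhds
  have hge : κ ≤ 0 := ge_of_tendsto hlim <| by
    filter_upwards [Ioo_mem_nhdsGT hδpos] with ε hε using hκle ε hε
  linarith

theorem abelIntegral_zero (α : ℝ) (q : ℝ → ℝ) : abelIntegral α q 0 = 0 := by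
  simp [abelIntegral]

theorem abelIntegral_neg (α : ℝ) (q : ℝ → ℝ) (t : ℝ) :
    abelIntegral α (fun s => -q s) t = -abelIntegral α q t := by
  simp [abelIntegral]

theorem abelIntegral_const_mul (α c : ℝ) (q : ℝ → ℝ) (t : ℝ) :
    abelIntegral α (fun s => c * q s) t = c * abelIntegral α q t := by
  rw [abelIntegral, abelIntegral, ← intervalIntegral.integral_const_mul]
  congr 1
  funext s
  ring

theorem abelIntegral_sub {α : ℝ} (hα : 0 < α) {p q : ℝ → ℝ} (hp : Continuous p)
    (hq : Continuous q) (t : ℝ) :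
    abelIntegral α (fun s => p s - q s) t = abelIntegral α p t - abelIntegral α q t := by
  rw [abelIntegral, abelIntegral, abelIntegral,
    ← intervalIntegral.integral_sub (intervalIntegrable_abel hα hp _ _ _)
      (intervalIntegrable_abel hα hq _ _ _)]
  congr 1
  funext s
  ring

theorem rpow_mul_exp_neg_le_Gamma {R y : ℝ} (hR : 0 < R) (hy : 0 ≤ y) :
    R ^ y * Real.exp (-R) ≤ Real.Gamma (y + 1) := by
  rw [Real.Gamma_eq_integral (by linarith), ← integral_exp_neg_Ioi R,
    ← MeasureTheory.integral_const_mul]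
  have hG := Real.GammaIntegral_convergent (show 0 < y + 1 by linarith)
  have hsub : Set.Ioi R ⊆ Set.Ioi (0 : ℝ) := Set.Ioi_subset_Ioi hR.le
  calc ∫ x in Set.Ioi R, R ^ y * Real.exp (-x)
      ≤ ∫ x in Set.Ioi R, Real.exp (-x) * x ^ (y + 1 - 1) := by
        refine MeasureTheory.setIntegral_mono_on ?_ (hG.mono_set hsub) measurableSet_Ioi
          fun x hx => ?_
        · exact (integrableOn_exp_neg_Ioi R).const_mul _
        · rw [mul_comm, add_sub_cancel_right]
          exact mul_le_mul_of_nonneg_left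
            (Real.rpow_le_rpow hR.le (le_of_lt hx) hy) (Real.exp_pos _).le
    _ ≤ ∫ x in Set.Ioi (0 : ℝ), Real.exp (-x) * x ^ (y + 1 - 1) := by
        refine MeasureTheory.setIntegral_mono_set hG ?_ hsub.eventuallyLE
        filter_upwards [MeasureTheory.ae_restrict_mem measurableSet_Ioi] with x hx
        have : (0 : ℝ) < x := hx
        simp only [Pi.zero_apply]
        positivity

theorem summable_pow_div_Gamma {α b : ℝ} (hα : 0 < α) (hb : 1 ≤ b) (x : ℝ) :
    Summable fun n : ℕ => x ^ n / Real.Gamma ((n : ℝ) * α + b) := by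
  set R : ℝ := (2 * (|x| + 1)) ^ (1 / α) with hR
  have hx : 0 < 2 * (|x| + 1) := by positivity
  have hRpos : 0 < R := Real.rpow_pos_of_pos hx _
  have hRα : R ^ α = 2 * (|x| + 1) := by
    rw [hR, ← Real.rpow_mul hx.le, one_div_mul_cancel hα.ne', Real.rpow_one]
  set K : ℝ := (R ^ (b - 1) * Real.exp (-R))⁻¹ with hK
  have hKpos : 0 < K := by positivity
  refine Summable.of_norm_bounded
    ((summable_geometric_of_lt_one (by norm_num) (show (1 / 2 : ℝ) < 1 by norm_num)).mul_left K)
    fun n => ?_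
  have hy : 0 ≤ (n : ℝ) * α + b - 1 := by
    have : 0 ≤ (n : ℝ) * α := by positivity
    linarith
  have hG := rpow_mul_exp_neg_le_Gamma hRpos hy
  rw [sub_add_cancel] at hG
  have hpow : R ^ ((n : ℝ) * α + b - 1) = (2 * (|x| + 1)) ^ n * R ^ (b - 1) := by
    rw [add_sub_assoc, Real.rpow_add hRpos, mul_comm (n : ℝ) α, Real.rpow_mul hRpos.le, hRα,
      Real.rpow_natCast]
  rw [hpow] at hG
  have hGpos : 0 < Real.Gamma ((n : ℝ) * α + b) := Real.Gamma_pos_of_pos (by linarith)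
  rw [norm_div, norm_pow, Real.norm_eq_abs, Real.norm_eq_abs, abs_of_pos hGpos, div_le_iff₀ hGpos]
  have h1 : |x| ^ n ≤ (|x| + 1) ^ n := pow_le_pow_left₀ (abs_nonneg x) (by linarith) n
  refine h1.trans ?_
  calc (|x| + 1) ^ n
      = K * (1 / 2) ^ n * ((2 * (|x| + 1)) ^ n * R ^ (b - 1) * Real.exp (-R)) := by
        rw [hK, mul_pow, div_pow, one_pow]
        field_simp
    _ ≤ _ := mul_le_mul_of_nonneg_left hG (by positivity)

theorem mittagLeffler_zero (α : ℝ) : mittagLeffler α 0 = 1 := by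
  rw [mittagLeffler, tsum_eq_single 0]
  · simp
  · intro n hn
    simp [hn]

theorem continuous_mittagLeffler {α : ℝ} (hα : 0 < α) : Continuous (mittagLeffler α) := by
  rw [continuous_iff_continuousAt]
  intro x
  have hon : ContinuousOn (mittagLeffler α) (Metric.ball 0 (|x| + 1)) := by
    refine continuousOn_tsum (fun n => by fun_prop)
      (summable_pow_div_Gamma hα le_rfl (|x| + 1)) fun n y hy => ?_
    have hG : 0 < Real.Gamma ((n : ℝ) * α + 1) := Real.Gamma_pos_of_pos (by positivity)
    rw [norm_div, norm_pow, Real.norm_eq_abs (Real.Gamma _), abs_of_pos hG]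
    rw [mem_ball_zero_iff] at hy
    gcongr
  refine hon.continuousAt (Metric.isOpen_ball.mem_nhds ?_)
  simp

theorem continuous_mittagLeffler_rpow {α : ℝ} (hα : 0 < α) (c : ℝ) :
    Continuous fun t : ℝ => mittagLeffler α (c * t ^ α) :=
  (continuous_mittagLeffler hα).comp
    (continuous_const.mul (Real.continuous_rpow_const hα.le))

theorem abelIntegral_rpow {α β t : ℝ} (hα : 0 < α) (hβ : 0 ≤ β) (ht : 0 < t) :
    abelIntegral α (fun s => s ^ β) t
      = Real.Gamma α * Real.Gamma (β + 1) / Real.Gamma (β + α + 1) * t ^ (β + α) := by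
  have hβ1 : 0 < β + 1 := by linarith
  have h := Complex.betaIntegral_scaled ((β + 1 : ℝ) : ℂ) (α : ℂ) ht
  have hB := ProbabilityTheory.beta_eq_betaIntegralReal (β + 1) α hβ1 hα
  have hL : ∫ x in (0 : ℝ)..t, (x : ℂ) ^ (((β + 1 : ℝ) : ℂ) - 1) * ((t : ℂ) - x) ^ ((α : ℂ) - 1)
      = ((abelIntegral α (fun s => s ^ β) t : ℝ) : ℂ) := by
    rw [abelIntegral, ← intervalIntegral.integral_ofReal]
    refine intervalIntegral.integral_congr fun x hx => ?_
    rw [Set.uIcc_of_le ht.le] at hx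
    have h1 : ((β + 1 : ℝ) : ℂ) - 1 = (β : ℂ) := by push_cast; ring
    rw [h1, Complex.ofReal_mul, Complex.ofReal_cpow hx.1,
      Complex.ofReal_cpow (sub_nonneg.2 hx.2), mul_comm]
    push_cast
    rfl
  have hR : (t : ℂ) ^ (((β + 1 : ℝ) : ℂ) + (α : ℂ) - 1) = ((t ^ (β + α) : ℝ) : ℂ) := by
    rw [Complex.ofReal_cpow ht.le]
    congr 1
    push_cast
    ring
  rw [hL, hR] at h
  have h2 := congrArg Complex.re h
  rw [Complex.ofReal_re, Complex.re_ofReal_mul, ← hB, ProbabilityTheory.beta] at h2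
  rw [h2, show β + 1 + α = β + α + 1 by ring]
  ring

/-- The function `t ↦ E_α(c t^α)` solves the linear fractional equation in Volterra form. -/
theorem mittagLeffler_rpow_eq {α : ℝ} (hα : 0 < α) (c : ℝ) {t : ℝ} (ht : 0 ≤ t) :
    mittagLeffler α (c * t ^ α)
      = 1 + c / Real.Gamma α * abelIntegral α (fun s => mittagLeffler α (c * s ^ α)) t := by
  rcases ht.eq_or_lt with rfl | ht
  · rw [Real.zero_rpow hα.ne', mul_zero, mittagLeffler_zero, abelIntegral_zero, mul_zero, add_zero]
  have hGα : 0 < Real.Gamma α := Real.Gamma_pos_of_pos hα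
  have hG : ∀ n : ℕ, 0 < Real.Gamma ((n : ℝ) * α + 1) := fun n =>
    Real.Gamma_pos_of_pos (by positivity)
  have hterm : ∀ (n : ℕ) (a : ℝ),
      abelIntegral α (fun s => (a * s ^ α) ^ n / Real.Gamma ((n : ℝ) * α + 1)) t
        = Real.Gamma α * t ^ α * ((a * t ^ α) ^ n / Real.Gamma ((n : ℝ) * α + (α + 1))) := by
    intro n a
    have h1 : abelIntegral α (fun s => (a * s ^ α) ^ n / Real.Gamma ((n : ℝ) * α + 1)) t
        = abelIntegral α (fun s => a ^ n / Real.Gamma ((n : ℝ) * α + 1) * s ^ ((n : ℝ) * α)) t := by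
      refine intervalIntegral.integral_congr fun s hs => ?_
      rw [Set.uIcc_of_le ht.le] at hs
      simp only []
      rw [mul_pow, ← Real.rpow_natCast (s ^ α), ← Real.rpow_mul hs.1, mul_comm α]
      ring
    rw [h1, abelIntegral_const_mul, abelIntegral_rpow hα (by positivity) ht, mul_pow,
      Real.rpow_add ht, ← Real.rpow_natCast (t ^ α), ← Real.rpow_mul ht.le, mul_comm α (n : ℝ),
      add_assoc]
    have := (hG n).ne'
    field_simp
  have hcont : ∀ (n : ℕ) (a : ℝ),
      Continuous fun s : ℝ => (a * s ^ α) ^ n / Real.Gamma ((n : ℝ) * α + 1) := fun n a =>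
    ((continuous_const.mul (Real.continuous_rpow_const hα.le)).pow n).div_const _
  have hsum := MeasureTheory.hasSum_integral_of_summable_integral_norm
    (μ := MeasureTheory.volume.restrict (Set.Ioc 0 t))
    (F := fun (n : ℕ) (s : ℝ) =>
      (t - s) ^ (α - 1) * ((c * s ^ α) ^ n / Real.Gamma ((n : ℝ) * α + 1)))
    (fun n => (intervalIntegrable_abel hα (hcont n c) 0 t t).1) ?_
  · have hsum' : HasSum
        (fun n : ℕ => Real.Gamma α * t ^ α *
          ((c * t ^ α) ^ n / Real.Gamma ((n : ℝ) * α + (α + 1))))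
        (abelIntegral α (fun s => mittagLeffler α (c * s ^ α)) t) := by
      convert! hsum using 1
      · funext n
        rw [← hterm n c, abelIntegral, intervalIntegral.integral_of_le ht.le]
      · rw [abelIntegral, intervalIntegral.integral_of_le ht.le]
        congr 1
        funext s
        rw [mittagLeffler, tsum_mul_left]
    rw [mittagLeffler, (summable_pow_div_Gamma hα le_rfl (c * t ^ α)).tsum_eq_zero_add,
      ← hsum'.tsum_eq, ← tsum_mul_left]
    congr 1
    · simp
    · refine tsum_congr fun n => ?_
      have h2 : ((n + 1 : ℕ) : ℝ) * α + 1 = (n : ℝ) * α + (α + 1) := by push_cast; ring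
      rw [h2, pow_succ]
      field_simp
  · have hnorm : ∀ n : ℕ, ∫ s in Set.Ioc 0 t,
        ‖(t - s) ^ (α - 1) * ((c * s ^ α) ^ n / Real.Gamma ((n : ℝ) * α + 1))‖
        = Real.Gamma α * t ^ α * ((|c| * t ^ α) ^ n / Real.Gamma ((n : ℝ) * α + (α + 1))) := by
      intro n
      rw [← hterm n |c|, abelIntegral, intervalIntegral.integral_of_le ht.le]
      refine MeasureTheory.setIntegral_congr_fun measurableSet_Ioc fun s hs => ?_
      rw [norm_mul, norm_div, norm_pow, norm_mul, Real.norm_of_nonneg (hG n).le,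
        Real.norm_of_nonneg (Real.rpow_nonneg (sub_nonneg.2 hs.2) _),
        Real.norm_of_nonneg (Real.rpow_nonneg hs.1.le _), Real.norm_eq_abs]
    simp only [hnorm]
    exact (summable_pow_div_Gamma hα (by linarith) (|c| * t ^ α)).mul_left _

theorem nonneg_of_forall_argmin {w : ℝ → ℝ} (hw : Continuous w) (h0 : 0 ≤ w 0)
    (h : ∀ t, 0 < t → (∀ s ∈ Set.Icc 0 t, w t ≤ w s) → 0 ≤ w t) {t : ℝ} (ht : 0 ≤ t) :
    0 ≤ w t := by
  obtain ⟨m, hm, hmin⟩ := isCompact_Icc.exists_isMinOn (Set.nonempty_Icc.2 ht)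
    (hw.continuousOn (s := Set.Icc 0 t))
  have hmt : w m ≤ w t := hmin ⟨ht, le_rfl⟩
  refine le_trans ?_ hmt
  rcases hm.1.eq_or_lt with h' | h'
  · rwa [← h']
  · exact h m h' fun s hs => hmin ⟨hs.1, hs.2.trans hm.2⟩

theorem mittagLeffler_rpow_nonneg {α c t : ℝ} (hα : α ∈ Set.Ioo (0 : ℝ) 1) (hc : c ≤ 0)
    (ht : 0 ≤ t) : 0 ≤ mittagLeffler α (c * t ^ α) := by
  have hcont := continuous_mittagLeffler_rpow hα.1 c
  have hGα : 0 < Real.Gamma α := Real.Gamma_pos_of_pos hα.1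
  rcases hc.eq_or_lt with rfl | hc
  · rw [zero_mul, mittagLeffler_zero]
    exact zero_le_one
  refine nonneg_of_forall_argmin hcont ?_ (fun r hr hmin => ?_) ht
  · rw [Real.zero_rpow hα.1.ne', mul_zero, mittagLeffler_zero]
    exact zero_le_one
  · refine neg_nonpos.1 (nonpos_of_abelIntegral_min hα hr hcont.fun_neg fun s hs => ?_)
    have h1 := hmin s hs
    rw [mittagLeffler_rpow_eq hα.1 c hr.le, mittagLeffler_rpow_eq hα.1 c hs.1] at h1
    rw [abelIntegral_neg, abelIntegral_neg]
    have h2 : c / Real.Gamma α < 0 := div_neg_of_neg_of_pos hc hGα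
    have h3 := (mul_le_mul_left_of_neg h2).1 (le_of_add_le_add_left h1)
    exact neg_le_neg h3

theorem mittagLeffler_neg_antitoneOn {α : ℝ} (hα : α ∈ Set.Ioo (0 : ℝ) 1) :
    AntitoneOn (fun x => mittagLeffler α (-x)) (Set.Ici 0) := by
  intro x hx y hy hxy
  have hx0 : 0 ≤ x := hx
  have hGα : 0 < Real.Gamma α := Real.Gamma_pos_of_pos hα.1
  have hcx := continuous_mittagLeffler_rpow hα.1 (-x)
  have hcy := continuous_mittagLeffler_rpow hα.1 (-y)
  rcases hxy.eq_or_lt with rfl | hxy'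
  · exact le_rfl
  have hq : Continuous fun t : ℝ =>
      y * mittagLeffler α (-y * t ^ α) - x * mittagLeffler α (-x * t ^ α) :=
    (hcy.const_mul y).sub (hcx.const_mul x)
  have hdiff : ∀ t : ℝ, 0 ≤ t → mittagLeffler α (-x * t ^ α) - mittagLeffler α (-y * t ^ α)
      = 1 / Real.Gamma α * abelIntegral α (fun t =>
        y * mittagLeffler α (-y * t ^ α) - x * mittagLeffler α (-x * t ^ α)) t := by
    intro t ht
    rw [abelIntegral_sub hα.1 (hcy.const_mul y) (hcx.const_mul x), abelIntegral_const_mul,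
      abelIntegral_const_mul, mittagLeffler_rpow_eq hα.1 (-x) ht,
      mittagLeffler_rpow_eq hα.1 (-y) ht]
    ring
  have hmain := nonneg_of_forall_argmin (hcx.fun_sub hcy) (by simp [Real.zero_rpow hα.1.ne'])
    (fun t ht hmin => ?_) (zero_le_one (α := ℝ))
  · simpa using hmain
  · have hqt := nonpos_of_abelIntegral_min hα ht hq fun s hs => by
      have h1 := hmin s hs
      rw [hdiff t ht.le, hdiff s hs.1] at h1
      exact le_of_mul_le_mul_left h1 (by positivity)
    have hxn := mittagLeffler_rpow_nonneg (c := -x) hα (by linarith) ht.le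
    have hy0 : 0 < y := by linarith
    rw [sub_nonneg]
    refine le_of_mul_le_mul_left ?_ hy0
    nlinarith

theorem mittagLeffler_neg_nonneg {α x : ℝ} (hα : α ∈ Set.Ioo (0 : ℝ) 1) (hx : 0 ≤ x) :
    0 ≤ mittagLeffler α (-x) := by
  simpa using mittagLeffler_rpow_nonneg (c := -x) (t := 1) hα (by linarith) zero_le_one

theorem mittagLeffler_neg_le_one {α x : ℝ} (hα : α ∈ Set.Ioo (0 : ℝ) 1) (hx : 0 ≤ x) :
    mittagLeffler α (-x) ≤ 1 := by
  simpa [mittagLeffler_zero] using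
    mittagLeffler_neg_antitoneOn hα (Set.mem_Ici.2 le_rfl) (Set.mem_Ici.2 hx) hx

theorem mul_mittagLeffler_neg_le {α x : ℝ} (hα : α ∈ Set.Ioo (0 : ℝ) 1) (hx : 0 ≤ x) :
    x * mittagLeffler α (-x) ≤ Real.Gamma (α + 1) := by
  have hGα : 0 < Real.Gamma α := Real.Gamma_pos_of_pos hα.1
  have hα0 := hα.1
  have heq := mittagLeffler_rpow_eq hα.1 (-x) (zero_le_one (α := ℝ))
  rw [Real.one_rpow, mul_one] at heq
  have hle : mittagLeffler α (-x) / α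
      ≤ abelIntegral α (fun s => mittagLeffler α (-x * s ^ α)) 1 := by
    have hint : ∫ s in (0 : ℝ)..1, (1 - s) ^ (α - 1) * mittagLeffler α (-x)
        = mittagLeffler α (-x) / α := by
      rw [intervalIntegral.integral_mul_const, integral_sub_rpow hα.1]
      simp
      ring
    rw [← hint]
    refine intervalIntegral.integral_mono_on zero_le_one
      ((intervalIntegrable_sub_rpow hα.1 _ _ _).mul_const _)
      (intervalIntegrable_abel hα.1 (continuous_mittagLeffler_rpow hα.1 _) _ _ _) fun s hs => ?_
    refine mul_le_mul_of_nonneg_left ?_ (Real.rpow_nonneg (sub_nonneg.2 hs.2) _)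
    have h1 : s ^ α ≤ 1 := Real.rpow_le_one hs.1 hs.2 hα.1.le
    have h0 : 0 ≤ s ^ α := Real.rpow_nonneg hs.1 _
    change mittagLeffler α (-x) ≤ mittagLeffler α (-x * s ^ α)
    rw [neg_mul]
    exact mittagLeffler_neg_antitoneOn hα (Set.mem_Ici.2 (mul_nonneg hx h0)) (Set.mem_Ici.2 hx)
      (mul_le_of_le_one_right hx h1)
  have hnn := mittagLeffler_neg_nonneg hα hx
  have h2 : x / Real.Gamma α * (mittagLeffler α (-x) / α)
      ≤ x / Real.Gamma α * abelIntegral α (fun s => mittagLeffler α (-x * s ^ α)) 1 :=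
    mul_le_mul_of_nonneg_left hle (by positivity)
  have h3 : x / Real.Gamma α * (mittagLeffler α (-x) / α) ≤ 1 := by
    have : -x / Real.Gamma α = -(x / Real.Gamma α) := neg_div _ _
    rw [this] at heq
    linarith
  rw [Real.Gamma_add_one hα.1.ne']
  rw [div_mul_div_comm, div_le_one (by positivity)] at h3
  linarith

/-- First-order characterisation of strong convexity. -/
theorem add_inner_add_le_of_convexOn_sub_sq {F : Type*} [NormedAddCommGroup F]
    [InnerProductSpace ℝ F] [CompleteSpace F] {φ : F → ℝ} {μ : ℝ} {x g : F}
    (hconv : ConvexOn ℝ Set.univ (fun x => φ x - μ / 2 * ‖x‖ ^ 2)) (hg : HasGradientAt φ g x)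
    (y : F) : φ x + inner ℝ g (y - x) + μ / 2 * ‖y - x‖ ^ 2 ≤ φ y := by
  have hline : ConvexOn ℝ Set.univ
      (fun τ : ℝ => φ (x + τ • (y - x)) - μ / 2 * ‖x + τ • (y - x)‖ ^ 2) := by
    have h := hconv.comp_affineMap (AffineMap.lineMap x y : ℝ →ᵃ[ℝ] F)
    simpa [Function.comp_def, AffineMap.lineMap_apply, add_comm] using h
  have hlin : HasDerivAt (fun τ : ℝ => x + τ • (y - x)) (y - x) 0 := by
    simpa using ((hasDerivAt_id (0 : ℝ)).smul_const (y - x)).const_add x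
  have hx0 : x + (0 : ℝ) • (y - x) = x := by simp
  have hφ : HasDerivAt (fun τ : ℝ => φ (x + τ • (y - x))) (inner ℝ g (y - x)) 0 := by
    have hg' : HasFDerivAt φ (InnerProductSpace.toDual ℝ F g) (x + (0 : ℝ) • (y - x)) := by
      rw [hx0]
      exact hg.hasFDerivAt
    simpa [Function.comp_def] using hg'.comp_hasDerivAt (0 : ℝ) hlin
  have hsq : HasDerivAt (fun τ : ℝ => ‖x + τ • (y - x)‖ ^ 2) (2 * inner ℝ x (y - x)) 0 := by
    simpa using hlin.norm_sq
  have h := hline.le_slope_of_hasDerivAt (Set.mem_univ 0) (Set.mem_univ 1) zero_lt_one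
    (hφ.sub (hsq.const_mul (μ / 2)))
  rw [slope_def_field] at h
  simp only [one_smul, zero_smul, add_zero, sub_zero, div_one, add_sub_cancel] at h
  have hexp : ‖y‖ ^ 2 = ‖x‖ ^ 2 + 2 * inner ℝ x (y - x) + ‖y - x‖ ^ 2 := by
    rw [← norm_add_sq_real, add_sub_cancel]
  rw [hexp] at h
  linarith

theorem polyak_lojasiewicz {F : Type*} [NormedAddCommGroup F] [InnerProductSpace ℝ F]
    [CompleteSpace F] {φ : F → ℝ} {μ : ℝ} (hμ : 0 < μ) {x g : F}
    (hconv : ConvexOn ℝ Set.univ (fun x => φ x - μ / 2 * ‖x‖ ^ 2)) (hg : HasGradientAt φ g x)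
    (y : F) : 2 * μ * (φ x - φ y) ≤ ‖g‖ ^ 2 := by
  have h1 := add_inner_add_le_of_convexOn_sub_sq hconv hg y
  have h2 : 0 ≤ ‖g + μ • (y - x)‖ ^ 2 := sq_nonneg _
  rw [norm_add_sq_real, inner_smul_right, norm_smul, mul_pow, Real.norm_eq_abs, sq_abs] at h2
  nlinarith

theorem sq_dist_le_of_forall_le {F : Type*} [NormedAddCommGroup F] [InnerProductSpace ℝ F]
    [CompleteSpace F] {φ : F → ℝ} {μ : ℝ}
    (hconv : ConvexOn ℝ Set.univ (fun x => φ x - μ / 2 * ‖x‖ ^ 2)) (hφ : Differentiable ℝ φ)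
    {xmin : F} (hmin : ∀ x, φ xmin ≤ φ x) (y : F) :
    μ / 2 * ‖y - xmin‖ ^ 2 ≤ φ y - φ xmin := by
  have h0 : gradient φ xmin = 0 := by
    have : fderiv ℝ φ xmin = 0 :=
      IsLocalMin.fderiv_eq_zero (Filter.Eventually.of_forall hmin)
    rw [gradient, this, map_zero]
  have h1 := add_inner_add_le_of_convexOn_sub_sq hconv (hφ xmin).hasGradientAt y
  rw [h0, inner_zero_left] at h1
  linarith

theorem inner_integral_sub_rpow_smul {F : Type*} [NormedAddCommGroup F] [InnerProductSpace ℝ F]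
    [CompleteSpace F] {α : ℝ} (hα : 0 < α) {f : ℝ → F} (hf : Continuous f) (a : F) (t : ℝ) :
    inner ℝ a (∫ s in (0 : ℝ)..t, ((t - s) ^ (α - 1)) • f s)
      = abelIntegral α (fun s => inner ℝ a (f s)) t := by
  have hint : IntervalIntegrable (fun s => ((t - s) ^ (α - 1)) • f s)
      MeasureTheory.volume 0 t :=
    (intervalIntegrable_sub_rpow hα 0 t t).smul_continuousOn hf.continuousOn
  have h := (innerSL ℝ a).intervalIntegral_comp_comm hint
  simp only [innerSL_apply_apply, inner_smul_right] at h
  exact h.symm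

theorem one_add_rpow_mul_mittagLeffler_le {α c t : ℝ} (hα : α ∈ Set.Ioo (0 : ℝ) 1) (hc : 0 < c)
    (ht : 0 ≤ t) :
    (1 + t) ^ α * mittagLeffler α (-(c * t ^ α)) ≤ 1 + Real.Gamma (α + 1) / c := by
  have htα : 0 ≤ t ^ α := Real.rpow_nonneg ht _
  have hx : 0 ≤ c * t ^ α := by positivity
  have h0 := mittagLeffler_neg_nonneg hα hx
  have h1 := mittagLeffler_neg_le_one hα hx
  have h2 := mul_mittagLeffler_neg_le hα hx
  have h3 : (1 + t) ^ α ≤ 1 + t ^ α := by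
    simpa using Real.rpow_add_le_add_rpow zero_le_one ht hα.1.le hα.2.le
  have h4 : t ^ α * mittagLeffler α (-(c * t ^ α)) ≤ Real.Gamma (α + 1) / c := by
    rw [le_div_iff₀ hc]
    linarith
  calc (1 + t) ^ α * mittagLeffler α (-(c * t ^ α))
      ≤ (1 + t ^ α) * mittagLeffler α (-(c * t ^ α)) := mul_le_mul_of_nonneg_right h3 h0
    _ ≤ _ := by linarith

/-- algebraic convergence of the time fractional gradient flow for a
`C¹`, `μ`-strongly convex potential `φ` on `ℝ^d` with global minimizer `u*`: for the
continuous solution of `u(t) = u₀ − (1/Γ(α)) ∫_0^t (t−s)^{α−1} ∇φ(u(s)) ds`,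
`φ(u(t)) − φ(u*) ≤ (φ(u₀) − φ(u*)) E_α(−2μ t^α)` and `‖u(t) − u*‖ ≤ C (1+t)^{−α/2}`. -/
theorem time_fractional_gradient_flow_convergence (α : ℝ) (hα : α ∈ Set.Ioo (0 : ℝ) 1)
    (d : ℕ) (μ : ℝ) (hμ : 0 < μ)
    (φ : EuclideanSpace ℝ (Fin d) → ℝ) (hφ : ContDiff ℝ 1 φ)
    (hconv : ConvexOn ℝ Set.univ (fun x => φ x - μ / 2 * ‖x‖ ^ 2))
    (ustar : EuclideanSpace ℝ (Fin d)) (hmin : ∀ x, φ ustar ≤ φ x)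
    (u₀ : EuclideanSpace ℝ (Fin d)) (u : ℝ → EuclideanSpace ℝ (Fin d))
    (hucont : Continuous u) (hu0 : u 0 = u₀)
    (hu : ∀ t : ℝ, 0 ≤ t →
      u t = u₀ - (1 / Real.Gamma α) •
        ∫ s in (0 : ℝ)..t, ((t - s) ^ (α - 1)) • gradient φ (u s)) :
    (∀ t : ℝ, 0 ≤ t →
      φ (u t) - φ ustar ≤ (φ u₀ - φ ustar) * mittagLeffler α (-2 * μ * t ^ α)) ∧
    ∃ C : ℝ, 0 < C ∧ ∀ t : ℝ, 0 ≤ t → ‖u t - ustar‖ ≤ C * (1 + t) ^ (-(α / 2)) := by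
  have hα0 := hα.1
  have hGα : 0 < Real.Gamma α := Real.Gamma_pos_of_pos hα0
  have hdiff : Differentiable ℝ φ := hφ.differentiable one_ne_zero
  have hgradc : Continuous (gradient φ) :=
    (InnerProductSpace.toDual ℝ _).symm.continuous.comp (hφ.continuous_fderiv one_ne_zero)
  have hf : Continuous fun s => gradient φ (u s) := hgradc.comp hucont
  set G₀ := φ u₀ - φ ustar with hG₀
  have hG₀nn : 0 ≤ G₀ := sub_nonneg.2 (hmin u₀)
  have hE := continuous_mittagLeffler_rpow hα0 (-2 * μ)
  have hdecay : ∀ t : ℝ, 0 ≤ t →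
      φ (u t) - φ ustar ≤ G₀ * mittagLeffler α (-2 * μ * t ^ α) := by
    intro t₀ ht₀
    have hw : Continuous fun t =>
        G₀ * mittagLeffler α (-2 * μ * t ^ α) - (φ (u t) - φ ustar) :=
      (hE.const_mul G₀).sub ((hφ.continuous.comp hucont).sub continuous_const)
    refine sub_nonneg.1 (nonneg_of_forall_argmin hw ?_ (fun t ht hargmin => ?_) ht₀)
    · rw [hu0, Real.zero_rpow hα0.ne', mul_zero, mittagLeffler_zero, mul_one, sub_self]
    · have hinner : Continuous fun s => inner ℝ (gradient φ (u t)) (gradient φ (u s)) :=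
        continuous_const.inner hf
      have habel : ∀ s : ℝ, 0 ≤ s →
          abelIntegral α (fun s => inner ℝ (gradient φ (u t)) (gradient φ (u s))
            - 2 * μ * G₀ * mittagLeffler α (-2 * μ * s ^ α)) s
          = Real.Gamma α * (inner ℝ (gradient φ (u t)) (u₀ - u s)
            - G₀ * (1 - mittagLeffler α (-2 * μ * s ^ α))) := by
        intro s hs
        have hus : u₀ - u s = (1 / Real.Gamma α) •
            ∫ r in (0 : ℝ)..s, ((s - r) ^ (α - 1)) • gradient φ (u r) := by
          conv_lhs => rw [hu s hs, sub_sub_cancel]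
        rw [abelIntegral_sub hα0 hinner (hE.const_mul _), abelIntegral_const_mul,
          ← inner_integral_sub_rpow_smul hα0 hf, mittagLeffler_rpow_eq hα0 (-2 * μ) hs]
        rw [hus, inner_smul_right]
        field_simp
        ring
      have hq := nonpos_of_abelIntegral_min hα ht (hinner.fun_sub (hE.const_mul (2 * μ * G₀)))
        fun s hs => by
          refine ((habel t ht.le).trans_le ?_).trans_eq (habel s hs.1).symm
          have h1 := hargmin s hs
          have h2 := add_inner_add_le_of_convexOn_sub_sq hconv (hdiff (u t)).hasGradientAt (u s)
          have h3 : 0 ≤ μ / 2 * ‖u s - u t‖ ^ 2 := by positivity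
          refine mul_le_mul_of_nonneg_left ?_ hGα.le
          simp only [inner_sub_right] at h2 ⊢
          linarith
      have hPL := polyak_lojasiewicz hμ hconv (hdiff (u t)).hasGradientAt ustar
      rw [real_inner_self_eq_norm_sq] at hq
      have h2μ : 0 < 2 * μ := by positivity
      refine sub_nonneg.2 (le_of_mul_le_mul_left ?_ h2μ)
      linarith
  refine ⟨hdecay, ?_⟩
  set K := 2 / μ * G₀ * (1 + Real.Gamma (α + 1) / (2 * μ)) with hK
  have hΓ : 0 < Real.Gamma (α + 1) := Real.Gamma_pos_of_pos (by linarith)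
  have hKnn : 0 ≤ K := by positivity
  refine ⟨√K + 1, by positivity, fun t ht => ?_⟩
  have ht1 : 0 < 1 + t := by linarith
  have hsq := sq_dist_le_of_forall_le hconv hdiff hmin (u t)
  have hE1 := one_add_rpow_mul_mittagLeffler_le hα (show 0 < 2 * μ by positivity) ht
  have harg : -2 * μ * t ^ α = -(2 * μ * t ^ α) := by ring
  have hd := hdecay t ht
  rw [harg] at hd
  have hp : 0 < (1 + t) ^ (-α) := Real.rpow_pos_of_pos ht1 _
  have hpp : (1 + t) ^ (-α) * (1 + t) ^ α = 1 := by
    rw [← Real.rpow_add ht1]; simp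
  have hnorm : ‖u t - ustar‖ ^ 2 ≤ K * (1 + t) ^ (-α) := by
    have h1 : mittagLeffler α (-(2 * μ * t ^ α))
        ≤ (1 + t) ^ (-α) * (1 + Real.Gamma (α + 1) / (2 * μ)) := by
      have := mul_le_mul_of_nonneg_left hE1 hp.le
      rwa [← mul_assoc, hpp, one_mul] at this
    have h2 : μ / 2 * ‖u t - ustar‖ ^ 2
        ≤ G₀ * ((1 + t) ^ (-α) * (1 + Real.Gamma (α + 1) / (2 * μ))) :=
      (hsq.trans hd).trans (mul_le_mul_of_nonneg_left h1 hG₀nn)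
    calc ‖u t - ustar‖ ^ 2 = 2 / μ * (μ / 2 * ‖u t - ustar‖ ^ 2) := by field_simp
      _ ≤ 2 / μ * (G₀ * ((1 + t) ^ (-α) * (1 + Real.Gamma (α + 1) / (2 * μ)))) :=
          mul_le_mul_of_nonneg_left h2 (by positivity)
      _ = K * (1 + t) ^ (-α) := by rw [hK]; ring
  have hhalf : ((1 + t) ^ (-(α / 2))) ^ 2 = (1 + t) ^ (-α) := by
    rw [← Real.rpow_natCast, ← Real.rpow_mul ht1.le]
    congr 1
    push_cast
    ring
  refine (le_abs_self _).trans (abs_le_of_sq_le_sq ?_ (by positivity))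
  rw [mul_pow, hhalf]
  refine hnorm.trans (mul_le_mul_of_nonneg_right ?_ hp.le)
  have := Real.sq_sqrt hKnn
  nlinarith [Real.sqrt_nonneg K]
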